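/- Let K be a division ring and U a left K-vector space. Let T be a 2-dimensional subspace of U × U such that each of the three subspaces T ∩ (U × {0}), T ∩ ({0} × U), and T ∩ Δ is 1-dimensional, where Δ = {(u,u) : u ∈ U} is the diagonal. Then there exists a nonzero u ∈ U with T = K·(u,0) ⊕ K·(0,u), i.e., T = Ku × Ku. -/

import Mathlib

/-- The diagonal submodule `Δ = {(u,u)} ⊆ U × U`. -/
def diagSubmodule (K U : Type*) [DivisionRing K] [AddCommGroup U] [Module K U] :
    Submodule K (U × U) :=
  LinearMap.range ((LinearMap.id : U →ₗ[K] U).prod (LinearMap.id : U →ₗ[K] U))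

/-- A 2-dimensional subspace `T` of `U × U` meeting `U × 0`, `0 × U` and the
diagonal each in a 1-dimensional subspace has the form `Ku × Ku` for some `u ≠ 0`. -/
theorem stmt_3 (K U : Type*) [DivisionRing K] [AddCommGroup U] [Module K U]
    (T : Submodule K (U × U)) (hT : Module.finrank K T = 2)
    (h1 : Module.finrank K ↥(T ⊓ (⊤ : Submodule K U).prod (⊥ : Submodule K U)) = 1)
    (h2 : Module.finrank K ↥(T ⊓ (⊥ : Submodule K U).prod (⊤ : Submodule K U)) = 1)
    (h3 : Module.finrank K ↥(T ⊓ diagSubmodule K U) = 1) :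
    ∃ u : U, u ≠ 0 ∧ T = (Submodule.span K {u}).prod (Submodule.span K {u}) := by
  have key : ∀ S : Submodule K (U × U), Module.finrank K ↥S = 1 → ∃ x ∈ S, x ≠ 0 := by
    intro S hS
    apply Submodule.exists_mem_ne_zero_of_ne_bot
    rintro rfl
    simp at hS
  obtain ⟨⟨a, a'⟩, ⟨haT, ha⟩, ha0⟩ := key _ h1
  obtain ⟨⟨b', b⟩, ⟨hbT, hb⟩, hb0⟩ := key _ h2
  obtain ⟨c', ⟨hcT, hc⟩, hc0⟩ := key _ h3
  obtain ⟨c, rfl⟩ := hc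
  have ha' : a' = 0 := by simpa using ha
  have hb' : b' = 0 := by simpa using hb
  subst ha' hb'
  have ha0 : a ≠ 0 := by
    rintro rfl
    exact ha0 rfl
  have hb0 : b ≠ 0 := by
    rintro rfl
    exact hb0 rfl
  have hc0 : c ≠ 0 := by
    rintro rfl
    exact hc0 (map_zero _)
  have hcT : (c, c) ∈ T := hcT
  have hli : LinearIndependent K ![((a, 0) : U × U), (0, b)] := by
    rw [LinearIndependent.pair_iff]
    intro s t hst
    simpa [ha0, hb0] using hst
  have hfin : Module.Finite K T := Module.finite_of_finrank_pos (by omega)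
  have hspan : Submodule.span K (Set.range ![((a, 0) : U × U), (0, b)]) = T := by
    apply Submodule.eq_of_le_of_finrank_eq
    · rw [Submodule.span_le]
      rintro _ ⟨i, rfl⟩
      fin_cases i
      · exact haT
      · exact hbT
    · rw [finrank_span_eq_card hli, hT]
      simp
  have hform : ∀ p ∈ T, ∃ x y : K, x • a = p.1 ∧ y • b = p.2 := by
    intro p hp
    rw [← hspan, Matrix.range_cons, Matrix.range_cons, Matrix.range_empty, Set.union_empty,
      Set.singleton_union, Submodule.mem_span_pair] at hp
    obtain ⟨x, y, rfl⟩ := hp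
    exact ⟨x, y, by simp, by simp⟩
  obtain ⟨x, y, hx, hy⟩ := hform _ hcT
  simp only at hx hy
  have hx0 : x ≠ 0 := by
    rintro rfl
    exact hc0 (by simpa using hx.symm)
  have hy0 : y ≠ 0 := by
    rintro rfl
    exact hc0 (by simpa using hy.symm)
  have hac : a = x⁻¹ • c := by rw [← hx, inv_smul_smul₀ hx0]
  have hbc : b = y⁻¹ • c := by rw [← hy, inv_smul_smul₀ hy0]
  refine ⟨c, hc0, le_antisymm ?_ ?_⟩
  · rintro ⟨p, q⟩ hp
    obtain ⟨s, t, hs, ht⟩ := hform _ hp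
    simp only at hs ht
    rw [Submodule.mem_prod, Submodule.mem_span_singleton, Submodule.mem_span_singleton]
    exact ⟨⟨s * x⁻¹, by rw [mul_smul, ← hac, hs]⟩, ⟨t * y⁻¹, by rw [mul_smul, ← hbc, ht]⟩⟩
  · rintro ⟨p, q⟩ hp
    rw [Submodule.mem_prod, Submodule.mem_span_singleton, Submodule.mem_span_singleton] at hp
    obtain ⟨⟨s, hs⟩, ⟨t, ht⟩⟩ := hp
    simp only at hs ht
    have := T.add_mem (T.smul_mem (s * x) haT) (T.smul_mem (t * y) hbT)
    simpa [mul_smul, hx, hy, hs, ht] using this
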